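/- Let q be a real number. Then for every integer n ≥ 1, with k_n = ⌊log₂ n⌋ and p_n = 2^{k_n}: S_q(n + p_n) = S_q(n) + (2q − 1)·S_q(p_n) − (n − p_n)·q^{k_n + 1}·(1 − q) + q·p_n. -/

import Mathlib

noncomputable section

open MeasureTheory Filter Finset

/-- Distance from `x` to the nearest integer. -/
def distInt (x : ℝ) : ℝ := |x - round x|

/-- The Takagi–Landsberg function with parameter `a`:
`𝒯_a(x) = ∑_{n≥0} a^n · dist(2^n x, ℤ)`. -/
def takagi (a : ℝ) (x : ℝ) : ℝ := ∑' n : ℕ, a ^ n * distInt (2 ^ n * x)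

/-- Weighted sum-of-binary-digits function: for `j = ∑ ω_i 2^i`,
`s_q(j) = ∑ ω_i q^{i+1}`. -/
def sqN (q : ℝ) (j : ℕ) : ℝ := ∑ i ∈ Finset.range j, if j.testBit i then q ^ (i + 1) else 0

/-- `S_q(n) = ∑_{j<n} s_q(j)`. -/
def Sq (q : ℝ) (n : ℕ) : ℝ := ∑ j ∈ Finset.range n, sqN q j

theorem sqN_eq_sum_range (q : ℝ) {j N : ℕ} (h : j < 2 ^ N) :
    sqN q j = ∑ i ∈ Finset.range N, if j.testBit i then q ^ (i + 1) else 0 := by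
  have key : ∀ {M K : ℕ}, M ≤ K → j < 2 ^ M →
      (∑ i ∈ Finset.range M, if j.testBit i then q ^ (i + 1) else 0) =
        ∑ i ∈ Finset.range K, if j.testBit i then q ^ (i + 1) else 0 := by
    intro M K hMK hM
    refine Finset.sum_subset (Finset.range_subset_range.2 hMK) fun i _ hi => ?_
    have hMi : M ≤ i := by simpa using hi
    have hj : j < 2 ^ i := hM.trans_le (Nat.pow_le_pow_right two_pos hMi)
    simp [Nat.testBit_lt_two_pow hj]
  rcases le_total j N with hjN | hjN
  · exact key hjN Nat.lt_two_pow_self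
  · exact (key hjN h).symm

theorem sqN_two_mul (q : ℝ) (j : ℕ) : sqN q (2 * j) = q * sqN q j := by
  have hj : j < 2 ^ j := Nat.lt_two_pow_self
  rw [sqN_eq_sum_range q (show 2 * j < 2 ^ (j + 1) by rw [pow_succ]; omega),
    Finset.sum_range_succ', sqN, Finset.mul_sum]
  simp [Nat.testBit_succ, pow_succ', mul_ite]

theorem sqN_two_mul_add_one (q : ℝ) (j : ℕ) : sqN q (2 * j + 1) = q * sqN q j + q := by
  have hj : j < 2 ^ j := Nat.lt_two_pow_self
  have hdiv : (2 * j + 1) / 2 = j := by omega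
  rw [sqN_eq_sum_range q (show 2 * j + 1 < 2 ^ (j + 1) by rw [pow_succ]; omega),
    Finset.sum_range_succ', sqN, Finset.mul_sum]
  simp [Nat.testBit_succ, hdiv, pow_succ', mul_ite]

theorem sqN_two_pow_add (q : ℝ) {k j : ℕ} (h : j < 2 ^ k) :
    sqN q (2 ^ k + j) = sqN q j + q ^ (k + 1) := by
  rw [sqN_eq_sum_range q (show 2 ^ k + j < 2 ^ (k + 1) by rw [pow_succ]; omega),
    Finset.sum_range_succ, sqN_eq_sum_range q h]
  congr 1
  · refine Finset.sum_congr rfl fun i hi => ?_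
    rw [Nat.testBit_two_pow_add_gt (Finset.mem_range.1 hi)]
  · simp [Nat.testBit_two_pow_add_eq, Nat.testBit_lt_two_pow h]

theorem Sq_two_mul (q : ℝ) (n : ℕ) : Sq q (2 * n) = 2 * q * Sq q n + q * n := by
  induction n with
  | zero => simp [Sq]
  | succ n ih =>
    have h : Sq q (2 * (n + 1)) = Sq q (2 * n) + sqN q (2 * n) + sqN q (2 * n + 1) := by
      rw [show 2 * (n + 1) = 2 * n + 1 + 1 by ring, Sq, Finset.sum_range_succ,
        Finset.sum_range_succ, Sq]
    have h' : Sq q (n + 1) = Sq q n + sqN q n := Finset.sum_range_succ _ _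
    rw [h, h', ih, sqN_two_mul, sqN_two_mul_add_one]
    push_cast
    ring

theorem Sq_two_pow_add (q : ℝ) {k m : ℕ} (h : m ≤ 2 ^ k) :
    Sq q (2 ^ k + m) = Sq q (2 ^ k) + Sq q m + m * q ^ (k + 1) := by
  have hs : ∑ j ∈ Finset.range m, sqN q (2 ^ k + j) =
      ∑ j ∈ Finset.range m, (sqN q j + q ^ (k + 1)) :=
    Finset.sum_congr rfl fun j hj =>
      sqN_two_pow_add q ((Finset.mem_range.1 hj).trans_le h)
  rw [Sq, Finset.sum_range_add, hs, Finset.sum_add_distrib]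
  simp [Sq, add_assoc]

theorem Sq_add_pow (q : ℝ) (n : ℕ) (hn : 1 ≤ n) (k : ℕ) (hk : k = Nat.log 2 n)
    (p : ℕ) (hp : p = 2 ^ k) :
    Sq q (n + p) = Sq q n + (2 * q - 1) * Sq q p
      - ((n : ℝ) - (p : ℝ)) * q ^ (k + 1) * (1 - q) + q * (p : ℝ) := by
  subst hp
  have hle : 2 ^ k ≤ n := hk ▸ Nat.pow_log_le_self 2 (by omega)
  have hlt : n < 2 ^ (k + 1) := hk ▸ Nat.lt_pow_succ_log_self one_lt_two n
  obtain ⟨m, rfl⟩ := Nat.exists_eq_add_of_le hle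
  have hm : m ≤ 2 ^ k := by rw [pow_succ] at hlt; omega
  have hm' : m ≤ 2 ^ (k + 1) := hm.trans (Nat.pow_le_pow_right two_pos k.le_succ)
  rw [show 2 ^ k + m + 2 ^ k = 2 ^ (k + 1) + m by ring, Sq_two_pow_add q hm,
    Sq_two_pow_add q hm', pow_succ' 2 k, Sq_two_mul]
  push_cast
  ring

end
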